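/- Let N = ∏_{i=1}^r n_i and let U be an N × N unitary complex matrix. There exist an N × N unitary V and n_i × n_i unitaries U_i (1 ≤ i ≤ r) such that U = V (U₁ ⊗ ⋯ ⊗ U_r) V* if and only if there exist complex numbers λ_{i,j} of modulus one (1 ≤ i ≤ r, 1 ≤ j ≤ n_i) such that the multiset of eigenvalues of U (counted with multiplicity) equals the multiset of products λ_{1,j₁} λ_{2,j₂} ⋯ λ_{r,j_r} over (j₁,…,j_r) ∈ ∏_i {1,…,n_i}. -/

import Mathlib

open Matrix

/-- The Kronecker (tensor) product of a family of square matrices, indexed by product types. -/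
def kronFamily {r : ℕ} {n : Fin r → ℕ} (M : ∀ i, Matrix (Fin (n i)) (Fin (n i)) ℂ) :
    Matrix (∀ i, Fin (n i)) (∀ i, Fin (n i)) ℂ :=
  fun a b => ∏ i, M i (a i) (b i)

open Module End in
theorem aux_isom_onb {ι E : Type*} [Fintype ι] [NormedAddCommGroup E] [InnerProductSpace ℂ E]
    [FiniteDimensional ℂ E] (hE : Module.finrank ℂ E = Fintype.card ι) (T : E →ₗ[ℂ] E)
    (hT : ∀ x y, inner ℂ (T x) (T y) = inner ℂ x y) :
    ∃ (b : OrthonormalBasis ι ℂ E) (d : ι → ℂ), ∀ i, T (b i) = d i • b i := by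
  classical
  have hnorm : ∀ (μ : ℂ) (v : E), T v = μ • v → v ≠ 0 →
      (starRingEnd ℂ) μ * μ = 1 := by
    intro μ v hv h0
    have h := hT v v
    rw [hv, inner_smul_left, inner_smul_right, ← mul_assoc] at h
    have h1 : inner ℂ v v ≠ 0 := by simpa using h0
    exact mul_right_cancel₀ h1 (by rw [h, one_mul])
  have hfam : OrthogonalFamily ℂ (fun μ => eigenspace T μ) fun μ => (eigenspace T μ).subtypeₗᵢ := by
    rintro μ ν hμν ⟨v, hv⟩ ⟨w, hw⟩
    by_cases hv0 : v = 0
    · simp [hv0]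
    rw [mem_eigenspace_iff] at hv hw
    have h1 := hnorm μ v hv hv0
    have h := hT v w
    rw [hv, hw, inner_smul_left, inner_smul_right, ← mul_assoc] at h
    change inner ℂ v w = 0
    by_contra hne
    have h2 : (starRingEnd ℂ) μ * ν = 1 := mul_right_cancel₀ hne (by rw [h, one_mul])
    have h3 : (starRingEnd ℂ) μ ≠ 0 := by
      intro h0
      simp [h0] at h1
    exact hμν (mul_left_cancel₀ h3 (h1.trans h2.symm))
  have hinv1 : ∀ (μ : ℂ) (v : E), v ∈ (eigenspace T μ)ᗮ →
      T v ∈ (eigenspace T μ)ᗮ := by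
    intro μ v hv w hw
    by_cases hw0 : w = 0
    · simp [hw0]
    have hv' := hv w hw
    rw [mem_eigenspace_iff] at hw
    have h1 := hnorm μ w hw hw0
    have h := hT w v
    rw [hv', hw, inner_smul_left] at h
    rcases mul_eq_zero.1 h with h0 | h0
    · simp [h0] at h1
    · exact h0
  have hinv : ∀ v ∈ (⨆ μ, eigenspace T μ)ᗮ, T v ∈ (⨆ μ, eigenspace T μ)ᗮ := by
    intro v hv
    rw [← Submodule.iInf_orthogonal] at hv ⊢
    exact T.iInf_invariant hinv1 v hv
  have hbot : (⨆ μ, eigenspace T μ)ᗮ = ⊥ := by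
    by_contra hne
    have : Nontrivial ((⨆ μ, eigenspace T μ)ᗮ : Submodule ℂ E) :=
      Submodule.nontrivial_iff_ne_bot.2 hne
    obtain ⟨μ, hμ⟩ := Module.End.exists_eigenvalue (T.restrict hinv)
    apply hμ
    have H₂ : eigenspace T μ ⟂ (⨆ μ, eigenspace T μ)ᗮ :=
      (Submodule.isOrtho_orthogonal_right _).mono_left (le_iSup _ _)
    exact eigenspace_restrict_eq_bot hinv H₂.disjoint
  have hbot' : (⨆ μ : Eigenvalues T, eigenspace T μ)ᗮ = ⊥ :=
    show (⨆ μ : { μ // eigenspace T μ ≠ ⊥ }, eigenspace T μ)ᗮ = ⊥ by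
      rw [iSup_ne_bot_subtype, hbot]
  have hfam' : OrthogonalFamily ℂ (fun μ : Eigenvalues T => eigenspace T μ) fun μ =>
      (eigenspace T μ).subtypeₗᵢ := hfam.comp Subtype.coe_injective
  have hinternal : DirectSum.IsInternal (fun μ : Eigenvalues T => eigenspace T μ) :=
    hfam'.isInternal_iff.2 hbot'
  let e : Fin (Fintype.card ι) ≃ ι := Fintype.equivOfCardEq (Fintype.card_fin _)
  refine ⟨(hinternal.subordinateOrthonormalBasis hE hfam').reindex e,
    fun i => (hinternal.subordinateOrthonormalBasisIndex hE (e.symm i) hfam' :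
      Eigenvalues T).val, fun i => ?_⟩
  rw [OrthonormalBasis.reindex_apply]
  exact mem_eigenspace_iff.1
    (hinternal.subordinateOrthonormalBasis_subordinate hE (e.symm i) hfam')

theorem aux_unitary_diag {ι : Type*} [Fintype ι] [DecidableEq ι] (U : Matrix ι ι ℂ)
    (hU : U ∈ Matrix.unitaryGroup ι ℂ) :
    ∃ V ∈ Matrix.unitaryGroup ι ℂ, ∃ d : ι → ℂ, (∀ i, ‖d i‖ = 1) ∧
      U = V * diagonal d * Vᴴ := by
  have hU1 : Uᴴ * U = 1 := Matrix.mem_unitaryGroup_iff'.1 hU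
  have hin : ∀ x y : EuclideanSpace ℂ ι,
      inner ℂ (Matrix.toEuclideanLin U x) (Matrix.toEuclideanLin U y) = inner ℂ x y := by
    intro x y
    rw [EuclideanSpace.inner_eq_star_dotProduct, EuclideanSpace.inner_eq_star_dotProduct]
    simp only [Matrix.toLpLin_apply]
    rw [Matrix.star_mulVec, dotProduct_comm, ← Matrix.dotProduct_mulVec, Matrix.mulVec_mulVec, hU1,
      Matrix.one_mulVec, dotProduct_comm]
  have hfr : Module.finrank ℂ (EuclideanSpace ℂ ι) = Fintype.card ι := finrank_euclideanSpace
  obtain ⟨b, d, hb⟩ := aux_isom_onb (E := EuclideanSpace ℂ ι) hfr (Matrix.toEuclideanLin U) hin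
  let V : Matrix ι ι ℂ := (EuclideanSpace.basisFun ι ℂ).toBasis.toMatrix b.toBasis
  have hV : V ∈ Matrix.unitaryGroup ι ℂ :=
    (EuclideanSpace.basisFun ι ℂ).toMatrix_orthonormalBasis_mem_unitary b
  have hV1 : V * Vᴴ = 1 := Matrix.mem_unitaryGroup_iff.1 hV
  have hVap : ∀ i j, V i j = b j i := fun i j => rfl
  have hUV : U * V = V * diagonal d := by
    ext i j
    have h := congrArg (fun x : EuclideanSpace ℂ ι => x i) (hb j)
    simp only [Matrix.toLpLin_apply] at h
    rw [Matrix.mul_diagonal, hVap, mul_comm]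
    exact h
  refine ⟨V, hV, d, fun j => ?_, ?_⟩
  · have h1 : ‖Matrix.toEuclideanLin U (b j)‖ = ‖b j‖ := by
      rw [@norm_eq_sqrt_re_inner ℂ, hin (b j) (b j), ← @norm_eq_sqrt_re_inner ℂ]
    rw [hb j, norm_smul, b.norm_eq_one, mul_one] at h1
    exact h1
  · rw [← hUV, mul_assoc, hV1, mul_one]

theorem aux_charpoly_roots {ι : Type*} [Fintype ι] [DecidableEq ι] (V : Matrix ι ι ℂ)
    (hV : V ∈ Matrix.unitaryGroup ι ℂ) (d : ι → ℂ) :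
    (V * diagonal d * Vᴴ).charpoly.roots = Multiset.map d Finset.univ.val := by
  have hV1 : Vᴴ * V = 1 := Matrix.mem_unitaryGroup_iff'.1 hV
  rw [Matrix.charpoly_mul_comm, ← mul_assoc, hV1, one_mul, Matrix.charpoly_diagonal]
  have h := Polynomial.roots_multiset_prod_X_sub_C (Multiset.map d Finset.univ.val)
  rw [Multiset.map_map] at h
  exact h

theorem aux_perm {ι : Type*} [Fintype ι] (f g : ι → ℂ)
    (h : Multiset.map f Finset.univ.val = Multiset.map g Finset.univ.val) :
    ∃ σ : Equiv.Perm ι, ∀ i, g (σ i) = f i := by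
  classical
  have hc : ∀ c, Nonempty ({a // f a = c} ≃ {b // g b = c}) := by
    intro c
    refine Fintype.card_eq.1 ?_
    have := congrArg (Multiset.count c) h
    rw [Multiset.count_map, Multiset.count_map] at this
    rw [Fintype.card_subtype, Fintype.card_subtype]
    simpa [Finset.card, eq_comm] using this
  exact ⟨Equiv.ofFiberEquiv fun c => (hc c).some, fun i => Equiv.ofFiberEquiv_map _ i⟩

theorem aux_kron_mul {r : ℕ} {n : Fin r → ℕ} (A B : ∀ i, Matrix (Fin (n i)) (Fin (n i)) ℂ) :
    kronFamily (fun i => A i * B i) = kronFamily A * kronFamily B := by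
  ext a b
  simp only [kronFamily, Matrix.mul_apply, Finset.prod_univ_sum, ← Finset.prod_mul_distrib,
    Fintype.piFinset_univ]

theorem aux_kron_diag {r : ℕ} {n : Fin r → ℕ} (d : ∀ i, Fin (n i) → ℂ) :
    kronFamily (fun i => diagonal (d i)) = diagonal (fun J => ∏ i, d i (J i)) := by
  ext a b
  by_cases hab : a = b
  · subst hab
    simp [kronFamily]
  · rw [Matrix.diagonal_apply_ne _ hab]
    obtain ⟨i, hi⟩ := Function.ne_iff.1 hab
    exact Finset.prod_eq_zero (Finset.mem_univ i) (Matrix.diagonal_apply_ne _ hi)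

theorem aux_kron_conjTranspose {r : ℕ} {n : Fin r → ℕ}
    (A : ∀ i, Matrix (Fin (n i)) (Fin (n i)) ℂ) :
    kronFamily (fun i => (A i)ᴴ) = (kronFamily A)ᴴ := by
  ext a b
  simp [kronFamily, Matrix.conjTranspose_apply]

theorem aux_kron_unitary {r : ℕ} {n : Fin r → ℕ} (A : ∀ i, Matrix (Fin (n i)) (Fin (n i)) ℂ)
    (hA : ∀ i, A i ∈ Matrix.unitaryGroup (Fin (n i)) ℂ) :
    kronFamily A ∈ Matrix.unitaryGroup (∀ i, Fin (n i)) ℂ := by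
  rw [Matrix.mem_unitaryGroup_iff, Matrix.star_eq_conjTranspose, ← aux_kron_conjTranspose,
    ← aux_kron_mul]
  have : (fun i => A i * (A i)ᴴ) = fun i => diagonal (fun _ => (1 : ℂ)) := by
    funext i
    rw [Matrix.diagonal_one]
    exact Matrix.mem_unitaryGroup_iff.1 (hA i)
  rw [this, aux_kron_diag]
  simp

/-- A unitary `U` of size `N = ∏ nᵢ` admits a hidden tensor decomposition
`U = V (U₁ ⊗ ⋯ ⊗ U_r) Vᴴ` with `V` unitary and each `Uᵢ` an `nᵢ × nᵢ` unitary iff there are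
modulus-one complex numbers `λ i j` such that the multiset of eigenvalues of `U` (with
multiplicity) is the multiset of products `λ 1 j₁ ⋯ λ r j_r`. -/
theorem unitary_kron_factorization_iff_eigenvalues {r : ℕ} (n : Fin r → ℕ)
    (U : Matrix (∀ i, Fin (n i)) (∀ i, Fin (n i)) ℂ)
    (hU : U ∈ Matrix.unitaryGroup (∀ i, Fin (n i)) ℂ) :
    (∃ V : Matrix.unitaryGroup (∀ i, Fin (n i)) ℂ,
     ∃ Us : ∀ i, Matrix (Fin (n i)) (Fin (n i)) ℂ,
       (∀ i, Us i ∈ Matrix.unitaryGroup (Fin (n i)) ℂ) ∧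
        U = (V : Matrix (∀ i, Fin (n i)) (∀ i, Fin (n i)) ℂ) * kronFamily Us *
          ((V : Matrix (∀ i, Fin (n i)) (∀ i, Fin (n i)) ℂ))ᴴ) ↔
    (∃ lam : ∀ i, Fin (n i) → ℂ, (∀ i j, ‖lam i j‖ = 1) ∧
      U.charpoly.roots =
        Multiset.map (fun J : ∀ i, Fin (n i) => ∏ i, lam i (J i)) Finset.univ.val) := by
  constructor
  · rintro ⟨V, Us, hUs, rfl⟩
    choose W hW d hd hWd using fun i => aux_unitary_diag (Us i) (hUs i)
    refine ⟨d, hd, ?_⟩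
    have hk : kronFamily Us = kronFamily W * diagonal (fun J => ∏ i, d i (J i)) *
        (kronFamily W)ᴴ := by
      rw [← aux_kron_diag, ← aux_kron_conjTranspose, ← aux_kron_mul, ← aux_kron_mul]
      exact congrArg kronFamily (funext hWd)
    have h2 : (V : Matrix (∀ i, Fin (n i)) (∀ i, Fin (n i)) ℂ) * kronFamily Us *
        (V : Matrix (∀ i, Fin (n i)) (∀ i, Fin (n i)) ℂ)ᴴ =
        ((V : Matrix (∀ i, Fin (n i)) (∀ i, Fin (n i)) ℂ) * kronFamily W) *
          diagonal (fun J => ∏ i, d i (J i)) *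
        ((V : Matrix (∀ i, Fin (n i)) (∀ i, Fin (n i)) ℂ) * kronFamily W)ᴴ := by
      rw [hk, Matrix.conjTranspose_mul]
      simp only [mul_assoc]
    rw [h2]
    exact aux_charpoly_roots _ (mul_mem V.2 (aux_kron_unitary W hW)) _
  · rintro ⟨lam, hlam, hroots⟩
    obtain ⟨W, hW, d, hd, hWd⟩ := aux_unitary_diag U hU
    have hr := aux_charpoly_roots W hW d
    rw [← hWd, hroots] at hr
    obtain ⟨σ, hσ⟩ := aux_perm _ _ hr
    have hW1 : W * Wᴴ = 1 := Matrix.mem_unitaryGroup_iff.1 hW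
    have hVu : W.submatrix id σ ∈ Matrix.unitaryGroup (∀ i, Fin (n i)) ℂ := by
      rw [Matrix.mem_unitaryGroup_iff, Matrix.star_eq_conjTranspose, Matrix.conjTranspose_submatrix,
        Matrix.submatrix_mul_equiv, hW1, Matrix.submatrix_id_id]
    refine ⟨⟨W.submatrix id σ, hVu⟩, fun i => diagonal (lam i), fun i => ?_, ?_⟩
    · rw [Matrix.mem_unitaryGroup_iff, Matrix.star_eq_conjTranspose, Matrix.diagonal_conjTranspose,
        Matrix.diagonal_mul_diagonal, ← Matrix.diagonal_one]
      congr 1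
      funext j
      have := Complex.mul_conj' (lam i j)
      rw [hlam i j] at this
      simpa using this
    · rw [aux_kron_diag]
      have : diagonal (fun J : ∀ i, Fin (n i) => ∏ i, lam i (J i)) = (diagonal d).submatrix σ σ := by
        rw [Matrix.submatrix_diagonal_equiv]
        congr 1
        funext J
        exact (hσ J).symm
      change U = W.submatrix id σ * _ * (W.submatrix id σ)ᴴ
      rw [this, Matrix.conjTranspose_submatrix, Matrix.submatrix_mul_equiv,
        Matrix.submatrix_mul_equiv, Matrix.submatrix_id_id]
      exact hWd
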